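/- Define J_0 :≡ 0 and J_{n+1} := T J_n for n ≥ 0 (so J_n = Tⁿ0). Then for every n ≥ 1: J_n ∈ S₀, x ≤ J_n(x) ≤ x + b̄ for all x ≥ 0, and the sequence is pointwise nondecreasing, i.e. J_n(x) ≤ J_{n+1}(x) for all x ∈ ℝ. -/

import Mathlib

open MeasureTheory Set Filter Topology

noncomputable section

/-- The constant `b̄ = β ∫ z⁺ ν(dz) / (1-β)`. -/
def bbar (ν : Measure ℝ) (β : ℝ) : ℝ := β * (∫ z, max z 0 ∂ν) / (1 - β)

/-- The dynamic programming operator `T`. -/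
def Tdiv (ν : Measure ℝ) (β γ : ℝ) (v : ℝ → ℝ) (x : ℝ) : ℝ :=
  if 0 ≤ x then
    sSup ((fun a => a - (β / γ) * Real.log
      ((∫ z in Ici (a - x), Real.exp (-(γ * v (x - a + z))) ∂ν)
        + (ν (Iio (a - x))).toReal)) '' Icc 0 x)
  else 0

/-- Membership in the set `S₀`. -/
def memS0 (ν : Measure ℝ) (β : ℝ) (v : ℝ → ℝ) : Prop :=
  (∀ x, 0 ≤ v x) ∧ (∀ x, 0 ≤ x → v x ≤ x + bbar ν β) ∧ (∀ x, x < 0 → v x = 0)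
    ∧ MonotoneOn v (Ici 0) ∧ ContinuousOn v (Ici 0)

/-- Membership in the set `S`. -/
def memS (ν : Measure ℝ) (β : ℝ) (v : ℝ → ℝ) : Prop :=
  (∀ x, 0 ≤ v x) ∧ (∀ x, 0 ≤ x → x ≤ v x ∧ v x ≤ x + bbar ν β) ∧ (∀ x, x < 0 → v x = 0)
    ∧ MonotoneOn v (Ici 0) ∧ ContinuousOn v (Ici 0)

/-- A decision rule. -/
def DecisionRule (α : ℝ → ℝ) : Prop :=
  Measurable α ∧ (∀ x, 0 ≤ x → α x ∈ Icc 0 x) ∧ (∀ x, x < 0 → α x = 0)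

/-- The operator `L_α` associated with a decision rule `α`. -/
def Ldiv (ν : Measure ℝ) (β γ : ℝ) (α : ℝ → ℝ) (v : ℝ → ℝ) (x : ℝ) : ℝ :=
  if 0 ≤ x then
    α x - (β / γ) * Real.log
      ((∫ z in Ici (α x - x), Real.exp (-(γ * v (x - α x + z))) ∂ν)
        + (ν (Iio (α x - x))).toReal)
  else 0

/-- The function `Γ` associated with a value function `J`. -/
def Gam (ν : Measure ℝ) (β γ : ℝ) (J : ℝ → ℝ) (x : ℝ) : ℝ :=
  -(β / γ) * Real.log
    ((∫ z in Ici (-x), Real.exp (-(γ * J (x + z))) ∂ν) + (ν (Iio (-x))).toReal)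

end

section

variable {ν : Measure ℝ} {β γ : ℝ} {v w : ℝ → ℝ}

lemma bbar_nonneg (ν : Measure ℝ) (hβ : β ∈ Ioo (0 : ℝ) 1) : 0 ≤ bbar ν β :=
  div_nonneg (mul_nonneg hβ.1.le (integral_nonneg fun _ => le_max_right _ _))
    (sub_nonneg.2 hβ.2.le)

lemma memS0_zero (ν : Measure ℝ) (hβ : β ∈ Ioo (0 : ℝ) 1) : memS0 ν β (fun _ => 0) :=
  ⟨fun _ => le_rfl, fun _ hx => add_nonneg hx (bbar_nonneg ν hβ), fun _ _ => rfl,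
    monotoneOn_const, continuousOn_const⟩

lemma memS0.monotone (hv : memS0 ν β v) : Monotone v := by
  intro x y hxy
  rcases lt_or_ge x 0 with hx | hx
  · rw [hv.2.2.1 x hx]
    exact hv.1 y
  · exact hv.2.2.2.1 hx (hx.trans hxy) hxy

lemma memS0.continuousAt (hv : memS0 ν β v) {x : ℝ} (hx : x ≠ 0) : ContinuousAt v x := by
  rcases lt_or_gt_of_ne hx with hx | hx
  · refine (continuousAt_const (y := (0 : ℝ))).congr ?_
    filter_upwards [Iio_mem_nhds hx] with y hy using (hv.2.2.1 y hy).symm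
  · exact hv.2.2.2.2.continuousAt (Ici_mem_nhds hx)

lemma memS0.exp_le_one (hv : memS0 ν β v) (hγ : 0 < γ) (x : ℝ) :
    Real.exp (-(γ * v x)) ≤ 1 :=
  Real.exp_le_one_iff.2 (neg_nonpos.2 (mul_nonneg hγ.le (hv.1 x)))

lemma memS0.measurable_exp (hv : memS0 ν β v) (y : ℝ) :
    Measurable fun z => Real.exp (-(γ * v (y + z))) :=
  ((hv.monotone.measurable.comp (measurable_const_add y)).const_mul γ).neg.exp

lemma Tdiv_eq_sSup_Gam {x : ℝ} (hx : 0 ≤ x) :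
    Tdiv ν β γ v x = sSup ((fun a => a + Gam ν β γ v (x - a)) '' Icc 0 x) := by
  simp only [Tdiv, if_pos hx, Gam, neg_sub, neg_mul, ← sub_eq_add_neg]

variable [IsProbabilityMeasure ν]

lemma memS0.integrable_exp (hv : memS0 ν β v) (hγ : 0 < γ) (y : ℝ) :
    Integrable (fun z => Real.exp (-(γ * v (y + z)))) ν := by
  refine (integrable_const (1 : ℝ)).mono' (hv.measurable_exp y).aestronglyMeasurable ?_
  refine Eventually.of_forall fun z => ?_
  rw [Real.norm_eq_abs, Real.abs_exp]
  exact hv.exp_le_one hγ _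

lemma memS0.integral_exp_pos (hv : memS0 ν β v) (hγ : 0 < γ) (y : ℝ) :
    0 < ∫ z, Real.exp (-(γ * v (y + z))) ∂ν :=
  MeasureTheory.integral_exp_pos (hv.integrable_exp hγ y)

/-- Since `v` vanishes on the negative half-line, `Γ` is the entropic risk measure of
`v (y + z)` over the whole line. -/
lemma memS0.Gam_eq (hv : memS0 ν β v) (hγ : 0 < γ) (y : ℝ) :
    Gam ν β γ v y = -(β / γ) * Real.log (∫ z, Real.exp (-(γ * v (y + z))) ∂ν) := by
  have h : ∫ z in Iio (-y), Real.exp (-(γ * v (y + z))) ∂ν = (ν (Iio (-y))).toReal := by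
    rw [setIntegral_congr_fun (g := fun _ => (1 : ℝ)) measurableSet_Iio]
    · simp [Measure.real]
    · intro z hz
      have hz' : y + z < 0 := by
        have := mem_Iio.1 hz
        linarith
      simp [hv.2.2.1 _ hz']
  have hsplit := integral_add_compl (measurableSet_Ici (a := -y)) (hv.integrable_exp hγ y)
  rw [compl_Ici, h] at hsplit
  rw [Gam, hsplit]

lemma memS0.Gam_nonneg (hv : memS0 ν β v) (hβ : β ∈ Ioo (0 : ℝ) 1) (hγ : 0 < γ) (y : ℝ) :
    0 ≤ Gam ν β γ v y := by
  have hle : ∫ z, Real.exp (-(γ * v (y + z))) ∂ν ≤ 1 := by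
    simpa using integral_mono (hv.integrable_exp hγ y) (integrable_const (1 : ℝ))
      fun z => hv.exp_le_one hγ (y + z)
  rw [hv.Gam_eq hγ]
  exact mul_nonneg_of_nonpos_of_nonpos (neg_nonpos.2 (div_pos hβ.1 hγ).le)
    (Real.log_nonpos (hv.integral_exp_pos hγ y).le hle)

lemma memS0.Gam_le_Gam (hv : memS0 ν β v) (hw : memS0 ν β w) (hβ : β ∈ Ioo (0 : ℝ) 1)
    (hγ : 0 < γ) {y y' : ℝ} (h : ∀ z, v (y + z) ≤ w (y' + z)) :
    Gam ν β γ v y ≤ Gam ν β γ w y' := by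
  rw [hv.Gam_eq hγ, hw.Gam_eq hγ]
  refine mul_le_mul_of_nonpos_left ?_ (neg_nonpos.2 (div_pos hβ.1 hγ).le)
  refine Real.log_le_log (hw.integral_exp_pos hγ y') ?_
  refine integral_mono (hw.integrable_exp hγ y') (hv.integrable_exp hγ y) fun z => ?_
  exact Real.exp_le_exp.2 (neg_le_neg (mul_le_mul_of_nonneg_left (h z) hγ.le))

lemma memS0.Gam_le (hv : memS0 ν β v) (hint : Integrable (fun z => max z 0) ν)
    (hβ : β ∈ Ioo (0 : ℝ) 1) (hγ : 0 < γ) {y : ℝ} (hy : 0 ≤ y) :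
    Gam ν β γ v y ≤ y + bbar ν β := by
  have hb := bbar_nonneg ν hβ
  have hvle (z : ℝ) : v (y + z) ≤ y + bbar ν β + max z 0 := by
    rcases lt_or_ge (y + z) 0 with h | h
    · rw [hv.2.2.1 _ h]
      have := le_max_right z 0
      linarith
    · have := hv.2.1 _ h
      have := le_max_left z 0
      linarith
  set m := ∫ z, max z 0 ∂ν with hm
  have hmean : ∫ z, (y + bbar ν β + max z 0) ∂ν = y + bbar ν β + m := by
    rw [integral_add (integrable_const _) hint]
    simp [hm]
  have hI : Integrable (fun z => -(γ * (y + bbar ν β + max z 0))) ν :=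
    (((integrable_const _).add hint).const_mul γ).neg
  have hexp : Integrable (fun z => Real.exp (-(γ * (y + bbar ν β + max z 0)))) ν := by
    refine (hv.integrable_exp hγ y).mono' (Real.continuous_exp.comp_aestronglyMeasurable hI.1) ?_
    refine Eventually.of_forall fun z => ?_
    rw [Real.norm_eq_abs, Real.abs_exp]
    exact Real.exp_le_exp.2 (neg_le_neg (mul_le_mul_of_nonneg_left (hvle z) hγ.le))
  have hjensen : Real.exp (-(γ * (y + bbar ν β + m))) ≤
      ∫ z, Real.exp (-(γ * (y + bbar ν β + max z 0))) ∂ν := by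
    have := convexOn_exp.map_integral_le Real.continuous_exp.continuousOn isClosed_univ
      (Eventually.of_forall fun z => mem_univ _) hI hexp
    rwa [integral_neg, integral_const_mul, hmean] at this
  have hlog : -(γ * (y + bbar ν β + m)) ≤
      Real.log (∫ z, Real.exp (-(γ * v (y + z))) ∂ν) := by
    rw [Real.le_log_iff_exp_le (hv.integral_exp_pos hγ y)]
    refine hjensen.trans (integral_mono hexp (hv.integrable_exp hγ y) fun z => ?_)
    exact Real.exp_le_exp.2 (neg_le_neg (mul_le_mul_of_nonneg_left (hvle z) hγ.le))
  have hbar : bbar ν β * (1 - β) = β * m := by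
    rw [bbar, div_mul_cancel₀ _ (sub_pos.2 hβ.2).ne']
  rw [hv.Gam_eq hγ]
  calc -(β / γ) * Real.log (∫ z, Real.exp (-(γ * v (y + z))) ∂ν)
      ≤ -(β / γ) * -(γ * (y + bbar ν β + m)) :=
        mul_le_mul_of_nonpos_left hlog (neg_nonpos.2 (div_pos hβ.1 hγ).le)
    _ = β * (y + bbar ν β + m) := by field_simp
    _ ≤ y + bbar ν β := by nlinarith [mul_nonneg hy (sub_pos.2 hβ.2).le]

lemma memS0.continuous_Gam (hv : memS0 ν β v) (hac : ν ≪ volume) (hγ : 0 < γ) :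
    Continuous (Gam ν β γ v) := by
  have hE : Continuous fun y => ∫ z, Real.exp (-(γ * v (y + z))) ∂ν := by
    refine continuous_iff_continuousAt.2 fun y => ?_
    refine continuousAt_of_dominated (bound := fun _ => 1)
      (Eventually.of_forall fun x => (hv.measurable_exp x).aestronglyMeasurable)
      (Eventually.of_forall fun x => Eventually.of_forall fun z => ?_) (integrable_const _) ?_
    · rw [Real.norm_eq_abs, Real.abs_exp]
      exact hv.exp_le_one hγ _
    · have hne : ∀ᵐ z ∂ν, z ≠ -y := hac.ae_le (Measure.ae_ne volume (-y))
      filter_upwards [hne] with z hz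
      have hyz : y + z ≠ 0 := fun h => hz (by linarith)
      have hc : ContinuousAt (fun x => v (x + z)) y :=
        ContinuousAt.comp (f := fun x => x + z) (hv.continuousAt hyz) (by fun_prop)
      exact Real.continuous_exp.continuousAt.comp (hc.const_mul γ).neg
  rw [funext (hv.Gam_eq hγ)]
  exact continuous_const.mul (hE.log fun y => (hv.integral_exp_pos hγ y).ne')

lemma memS0.add_Gam_le (hv : memS0 ν β v) (hint : Integrable (fun z => max z 0) ν)
    (hβ : β ∈ Ioo (0 : ℝ) 1) (hγ : 0 < γ) {x a : ℝ} (ha : a ≤ x) :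
    a + Gam ν β γ v (x - a) ≤ x + bbar ν β := by
  have := hv.Gam_le hint hβ hγ (sub_nonneg.2 ha)
  linarith

lemma memS0.Tdiv_le (hv : memS0 ν β v) (hint : Integrable (fun z => max z 0) ν)
    (hβ : β ∈ Ioo (0 : ℝ) 1) (hγ : 0 < γ) {x : ℝ} (hx : 0 ≤ x) :
    Tdiv ν β γ v x ≤ x + bbar ν β := by
  rw [Tdiv_eq_sSup_Gam hx]
  refine csSup_le ((nonempty_Icc.2 hx).image _) ?_
  rintro _ ⟨a, ha, rfl⟩
  exact hv.add_Gam_le hint hβ hγ ha.2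

lemma memS0.le_Tdiv_of_mem (hv : memS0 ν β v) (hint : Integrable (fun z => max z 0) ν)
    (hβ : β ∈ Ioo (0 : ℝ) 1) (hγ : 0 < γ) {x a : ℝ} (ha : a ∈ Icc 0 x) :
    a + Gam ν β γ v (x - a) ≤ Tdiv ν β γ v x := by
  rw [Tdiv_eq_sSup_Gam (ha.1.trans ha.2)]
  refine le_csSup ⟨x + bbar ν β, ?_⟩ (mem_image_of_mem _ ha)
  rintro _ ⟨b, hb, rfl⟩
  exact hv.add_Gam_le hint hβ hγ hb.2

lemma memS0.le_Tdiv (hv : memS0 ν β v) (hint : Integrable (fun z => max z 0) ν)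
    (hβ : β ∈ Ioo (0 : ℝ) 1) (hγ : 0 < γ) {x : ℝ} (hx : 0 ≤ x) :
    x ≤ Tdiv ν β γ v x :=
  (le_add_of_nonneg_right (hv.Gam_nonneg hβ hγ _)).trans
    (hv.le_Tdiv_of_mem hint hβ hγ (right_mem_Icc.2 hx))

/-- `T` is monotone jointly in the function and the argument. -/
lemma memS0.Tdiv_le_Tdiv (hv : memS0 ν β v) (hw : memS0 ν β w)
    (hint : Integrable (fun z => max z 0) ν) (hβ : β ∈ Ioo (0 : ℝ) 1) (hγ : 0 < γ)
    (hvw : v ≤ w) {x x' : ℝ} (hx : 0 ≤ x) (hxx' : x ≤ x') :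
    Tdiv ν β γ v x ≤ Tdiv ν β γ w x' := by
  rw [Tdiv_eq_sSup_Gam hx]
  refine csSup_le ((nonempty_Icc.2 hx).image _) ?_
  rintro _ ⟨a, ha, rfl⟩
  have hG : Gam ν β γ v (x - a) ≤ Gam ν β γ w (x' - a) :=
    hv.Gam_le_Gam hw hβ hγ fun z => (hvw _).trans (hw.monotone (by linarith))
  exact (add_le_add_right hG a).trans
    (hw.le_Tdiv_of_mem hint hβ hγ ⟨ha.1, ha.2.trans hxx'⟩)

lemma memS0.continuousOn_Tdiv (hv : memS0 ν β v) (hac : ν ≪ volume) (hγ : 0 < γ) :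
    ContinuousOn (Tdiv ν β γ v) (Ici 0) := by
  have hG := hv.continuous_Gam hac hγ
  have hc : Continuous fun x : ℝ =>
      sSup ((fun s : ℝ => s * x + Gam ν β γ v (x - s * x)) '' Icc 0 1) :=
    (isCompact_Icc (a := (0 : ℝ)) (b := 1)).continuous_sSup
      (f := fun x s => s * x + Gam ν β γ v (x - s * x)) (by
        simp only [Function.HasUncurry.uncurry, id]
        fun_prop)
  refine hc.continuousOn.congr fun x hx => ?_
  have himage : (fun s : ℝ => s * x) '' Icc 0 1 = Icc 0 x := by
    simpa using image_mul_right_Icc zero_le_one (mem_Ici.1 hx)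
  rw [Tdiv_eq_sSup_Gam hx, ← himage, image_image]

lemma memS0.Tdiv (hv : memS0 ν β v) (hac : ν ≪ volume)
    (hint : Integrable (fun z => max z 0) ν) (hβ : β ∈ Ioo (0 : ℝ) 1) (hγ : 0 < γ) :
    memS0 ν β (Tdiv ν β γ v) := by
  have hneg (x : ℝ) (hx : x < 0) : _root_.Tdiv ν β γ v x = 0 := if_neg hx.not_ge
  refine ⟨fun x => ?_, fun x => hv.Tdiv_le hint hβ hγ, hneg,
    fun x hx y _ hxy => hv.Tdiv_le_Tdiv hv hint hβ hγ le_rfl hx hxy,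
    hv.continuousOn_Tdiv hac hγ⟩
  rcases lt_or_ge x 0 with hx | hx
  · exact (hneg x hx).ge
  · exact hx.trans (hv.le_Tdiv hint hβ hγ hx)

end

/-- properties of the value iteration `Jₙ = Tⁿ 0`. -/
theorem value_iteration_properties (ν : Measure ℝ) [IsProbabilityMeasure ν]
    (hac : ν ≪ volume) (hint : Integrable (fun z => max z 0) ν)
    (hneg : 0 < ν (Iio 0)) (β γ : ℝ) (hβ : β ∈ Ioo (0:ℝ) 1) (hγ : 0 < γ) :
    (∀ n : ℕ, 1 ≤ n → memS0 ν β ((Tdiv ν β γ)^[n] (fun _ => 0))) ∧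
    (∀ n : ℕ, 1 ≤ n → ∀ x : ℝ, 0 ≤ x →
      x ≤ (Tdiv ν β γ)^[n] (fun _ => 0) x ∧
      (Tdiv ν β γ)^[n] (fun _ => 0) x ≤ x + bbar ν β) ∧
    (∀ n : ℕ, ∀ x : ℝ,
      (Tdiv ν β γ)^[n] (fun _ => 0) x ≤ (Tdiv ν β γ)^[n + 1] (fun _ => 0) x) := by
  have hmem (n : ℕ) : memS0 ν β ((Tdiv ν β γ)^[n] fun _ => 0) := by
    induction n with
    | zero => exact memS0_zero ν hβ
    | succ n ih =>
      rw [Function.iterate_succ_apply']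
      exact ih.Tdiv hac hint hβ hγ
  refine ⟨fun n _ => hmem n, fun n hn x hx => ⟨?_, (hmem n).2.1 x hx⟩, fun n => ?_⟩
  · obtain ⟨k, rfl⟩ := Nat.exists_eq_add_of_le' hn
    rw [Function.iterate_succ_apply']
    exact (hmem k).le_Tdiv hint hβ hγ hx
  · induction n with
    | zero => exact (hmem 1).1
    | succ n ih =>
      intro x
      rcases lt_or_ge x 0 with hx | hx
      · rw [(hmem _).2.2.1 x hx, (hmem _).2.2.1 x hx]
      · rw [Function.iterate_succ_apply' _ (n + 1)]
        nth_rw 1 [Function.iterate_succ_apply']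
        exact (hmem n).Tdiv_le_Tdiv (hmem (n + 1)) hint hβ hγ ih hx le_rfl
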